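/- If ρ_α ≥ 1/2 and ρ_β ≥ 1/2, then for every n ∈ ℕ the Widom factor satisfies 𝒲_n(ρ_α,ρ_β) ≤ (2ρ_α/(ρ_α+ρ_β))^{ρ_α} · (2ρ_β/(ρ_α+ρ_β))^{ρ_β}, and moreover 𝒲_n(ρ_α,ρ_β) decreases monotonically to 2^{1-ρ_α-ρ_β} as n → ∞. -/

import Mathlib

open Filter

/-- The weighted sup `sup_{x ∈ [-1,1]} (1-x)^ρα (1+x)^ρβ |P(x)|`. -/
noncomputable def jacobiSup (ρa ρb : ℝ) (P : Polynomial ℝ) : ℝ :=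
  sSup ((fun x : ℝ => (1 - x) ^ ρa * (1 + x) ^ ρb * |P.eval x|) '' Set.Icc (-1 : ℝ) 1)

/-- The Widom factor `𝒲_n(ρα, ρβ)` for the Jacobi weight `(1-x)^ρα (1+x)^ρβ` on `[-1,1]`. -/
noncomputable def widomFactor (ρa ρb : ℝ) (n : ℕ) : ℝ :=
  2 ^ n * sInf (jacobiSup ρa ρb '' {P : Polynomial ℝ | P.Monic ∧ P.natDegree = n})

/-- The Jacobi weight `(1-x)^a (1+x)^b`. -/
noncomputable def jacobiWeight (a b x : ℝ) : ℝ := (1 - x) ^ a * (1 + x) ^ b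

lemma jacobiWeight_nonneg {a b x : ℝ} (hx : x ∈ Set.Icc (-1 : ℝ) 1) :
    0 ≤ jacobiWeight a b x :=
  mul_nonneg (Real.rpow_nonneg (by linarith [hx.2]) _) (Real.rpow_nonneg (by linarith [hx.1]) _)

lemma jacobiWeight_pos {a b x : ℝ} (hx : x ∈ Set.Ioo (-1 : ℝ) 1) :
    0 < jacobiWeight a b x :=
  mul_pos (Real.rpow_pos_of_pos (by linarith [hx.2]) _)
    (Real.rpow_pos_of_pos (by linarith [hx.1]) _)

lemma continuous_jacobiWeight {a b : ℝ} (ha : 0 ≤ a) (hb : 0 ≤ b) :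
    Continuous (jacobiWeight a b) :=
  ((continuous_const.sub continuous_id).rpow_const fun _ => Or.inr ha).mul
    ((continuous_const.add continuous_id).rpow_const fun _ => Or.inr hb)

lemma hasDerivAt_jacobiWeight (a b : ℝ) {x : ℝ} (hx : x ∈ Set.Ioo (-1 : ℝ) 1) :
    HasDerivAt (jacobiWeight a b)
      (jacobiWeight a b x * (b * (1 - x) - a * (1 + x)) / (1 - x ^ 2)) x := by
  have h1 : 0 < 1 - x := by linarith [hx.2]
  have h2 : 0 < 1 + x := by linarith [hx.1]
  have d1 : HasDerivAt (fun y : ℝ => (1 - y) ^ a) (-1 * a * (1 - x) ^ (a - 1)) x :=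
    ((hasDerivAt_id x).const_sub 1).rpow_const (Or.inl h1.ne')
  have d2 : HasDerivAt (fun y : ℝ => (1 + y) ^ b) (1 * b * (1 + x) ^ (b - 1)) x :=
    ((hasDerivAt_id x).const_add 1).rpow_const (Or.inl h2.ne')
  have h3 : 1 - x ^ 2 ≠ 0 := by nlinarith
  refine HasDerivAt.congr_deriv (f := jacobiWeight a b) (d1.mul d2) ?_
  rw [Real.rpow_sub_one h1.ne', Real.rpow_sub_one h2.ne']
  simp only [jacobiWeight]
  field_simp
  ring

/-- The squared weight with both exponents lowered by `1/2`. -/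
lemma jacobiWeight_sq {a b x : ℝ} (ha : 1 / 2 ≤ a) (hb : 1 / 2 ≤ b)
    (hx : x ∈ Set.Icc (-1 : ℝ) 1) :
    jacobiWeight a b x ^ 2 = jacobiWeight (2 * a - 1) (2 * b - 1) x * (1 - x ^ 2) := by
  have aux : ∀ {c y : ℝ}, 1 / 2 ≤ c → 0 ≤ y → (y ^ c) ^ 2 = y ^ (2 * c - 1) * y := by
    intro c y hc hy
    rw [← Real.rpow_natCast, ← Real.rpow_mul hy]
    conv_rhs => rw [← Real.rpow_one y, ← Real.rpow_mul hy, one_mul]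
    rw [← Real.rpow_add_of_nonneg hy (by linarith) zero_le_one]
    congr 1
    push_cast
    ring
  rw [jacobiWeight, mul_pow, aux ha (by linarith [hx.2]), aux hb (by linarith [hx.1]),
    jacobiWeight]
  ring

lemma bddAbove_jacobiSup {ρa ρb : ℝ} (ha : 0 ≤ ρa) (hb : 0 ≤ ρb) (P : Polynomial ℝ) :
    BddAbove ((fun x : ℝ => (1 - x) ^ ρa * (1 + x) ^ ρb * |P.eval x|) '' Set.Icc (-1 : ℝ) 1) :=
  (isCompact_Icc.image
    ((continuous_jacobiWeight ha hb).mul P.continuous.abs)).bddAbove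

lemma le_jacobiSup {ρa ρb : ℝ} (ha : 0 ≤ ρa) (hb : 0 ≤ ρb) (P : Polynomial ℝ) {x : ℝ}
    (hx : x ∈ Set.Icc (-1 : ℝ) 1) :
    jacobiWeight ρa ρb x * |P.eval x| ≤ jacobiSup ρa ρb P :=
  le_csSup (bddAbove_jacobiSup ha hb P) ⟨x, hx, rfl⟩

lemma jacobiSup_le {ρa ρb C : ℝ} {P : Polynomial ℝ}
    (h : ∀ x ∈ Set.Icc (-1 : ℝ) 1, jacobiWeight ρa ρb x * |P.eval x| ≤ C) :
    jacobiSup ρa ρb P ≤ C := by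
  refine csSup_le ⟨_, 0, by norm_num, rfl⟩ ?_
  rintro _ ⟨x, hx, rfl⟩
  exact h x hx

lemma jacobiSup_nonneg {ρa ρb : ℝ} (ha : 0 ≤ ρa) (hb : 0 ≤ ρb) (P : Polynomial ℝ) :
    0 ≤ jacobiSup ρa ρb P :=
  (mul_nonneg (jacobiWeight_nonneg (x := 0) (by norm_num)) (abs_nonneg _)).trans
    (le_jacobiSup ha hb P (x := 0) (by norm_num))

lemma widomFactor_le {ρa ρb C : ℝ} (ha : 0 ≤ ρa) (hb : 0 ≤ ρb) {n : ℕ} {P : Polynomial ℝ}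
    (hP : P.Monic) (hn : P.natDegree = n)
    (h : ∀ x ∈ Set.Icc (-1 : ℝ) 1, jacobiWeight ρa ρb x * |P.eval x| ≤ C) :
    widomFactor ρa ρb n ≤ 2 ^ n * C := by
  refine mul_le_mul_of_nonneg_left ?_ (by positivity)
  refine (csInf_le ⟨0, ?_⟩ (Set.mem_image_of_mem _
    (show P ∈ {P : Polynomial ℝ | P.Monic ∧ P.natDegree = n} from ⟨hP, hn⟩))).trans (jacobiSup_le h)
  rintro _ ⟨Q, -, rfl⟩
  exact jacobiSup_nonneg ha hb Q

/-- A monic polynomial of degree `n` minimising the weighted sup norm exists. -/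
lemma exists_minimizer {ρa ρb : ℝ} (ha : 0 ≤ ρa) (hb : 0 ≤ ρb) (n : ℕ) :
    ∃ P : Polynomial ℝ, P.Monic ∧ P.natDegree = n ∧
      ∀ R : Polynomial ℝ, R.Monic → R.natDegree = n → jacobiSup ρa ρb P ≤ jacobiSup ρa ρb R := by
  let I : Set ℝ := Set.Icc (-1 : ℝ) 1
  let w : C(I, ℝ) := ⟨fun x => jacobiWeight ρa ρb x,
    (continuous_jacobiWeight ha hb).comp continuous_subtype_val⟩
  let T : Polynomial ℝ →ₗ[ℝ] C(I, ℝ) :=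
    (LinearMap.mulLeft ℝ w).comp (Polynomial.toContinuousMapOnAlgHom I).toLinearMap
  have hT : ∀ (P : Polynomial ℝ) (x : I), T P x = jacobiWeight ρa ρb x * P.eval (x : ℝ) :=
    fun P x => rfl
  have hsup : ∀ P : Polynomial ℝ, ‖T P‖ = jacobiSup ρa ρb P := by
    intro P
    apply le_antisymm
    · refine (ContinuousMap.norm_le _ (jacobiSup_nonneg ha hb P)).2 fun x => ?_
      rw [hT, norm_mul, Real.norm_of_nonneg (jacobiWeight_nonneg x.2)]
      exact le_jacobiSup ha hb P x.2
    · refine jacobiSup_le fun x hx => ?_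
      have := (T P).norm_coe_le_norm ⟨x, hx⟩
      rwa [hT, norm_mul, Real.norm_of_nonneg (jacobiWeight_nonneg hx)] at this
  let W : Submodule ℝ C(I, ℝ) := (Polynomial.degreeLT ℝ n).map T
  have : FiniteDimensional ℝ (Polynomial.degreeLT ℝ n) :=
    (Polynomial.degreeLTEquiv ℝ n).symm.finiteDimensional
  have : FiniteDimensional ℝ W := inferInstanceAs (FiniteDimensional ℝ (Submodule.map _ _))
  have : ProperSpace W := FiniteDimensional.proper ℝ W
  have hlim : Tendsto (fun g : W => ‖T (Polynomial.X ^ n) + g‖) (cocompact W) atTop := by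
    refine tendsto_atTop_mono (f := fun g : W => ‖g‖ + -‖T (Polynomial.X ^ n)‖) (fun g => ?_)
      (tendsto_atTop_add_const_right _ _ tendsto_norm_cocompact_atTop)
    have := norm_sub_le (T (Polynomial.X ^ n) + (g : C(I, ℝ))) (T (Polynomial.X ^ n))
    rw [add_sub_cancel_left] at this
    have h2 : ‖(g : C(I, ℝ))‖ = ‖g‖ := rfl
    linarith
  obtain ⟨⟨g, q, hq, rfl⟩, hg⟩ :=
    Continuous.exists_forall_le (by fun_prop : Continuous fun g : W => ‖T (Polynomial.X ^ n) + g‖)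
      hlim
  have hq' := Polynomial.mem_degreeLT.1 hq
  refine ⟨Polynomial.X ^ n + q, Polynomial.monic_X_pow_add hq', ?_, fun R hR hRn => ?_⟩
  · refine Polynomial.natDegree_eq_of_degree_eq_some ?_
    rw [Polynomial.degree_add_eq_left_of_degree_lt] <;> simp [hq']
  · have hlt : R - Polynomial.X ^ n ∈ Polynomial.degreeLT ℝ n := by
      rw [Polynomial.mem_degreeLT]
      have hd : R.degree = n := by rw [Polynomial.degree_eq_natDegree hR.ne_zero, hRn]
      have := Polynomial.degree_sub_lt_left (p := R) (q := Polynomial.X ^ n)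
        (by rw [hd, Polynomial.degree_X_pow]) hR.ne_zero
        (by rw [hR.leadingCoeff, (Polynomial.monic_X_pow n).leadingCoeff])
      rwa [hd] at this
    have := hg ⟨T (R - Polynomial.X ^ n), _, hlt, rfl⟩
    simp only [← map_add, add_sub_cancel] at this
    rwa [hsup, hsup] at this

lemma jacobiSup_pos {ρa ρb : ℝ} (ha : 0 ≤ ρa) (hb : 0 ≤ ρb) {P : Polynomial ℝ} (hP : P ≠ 0) :
    0 < jacobiSup ρa ρb P := by
  refine (jacobiSup_nonneg ha hb P).lt_of_ne fun h => hP ?_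
  refine Polynomial.eq_zero_of_infinite_isRoot P
    ((Set.Ioo_infinite (by norm_num : (-1 : ℝ) < 1)).mono fun x hx => ?_)
  have h1 := le_jacobiSup ha hb P (Set.Ioo_subset_Icc_self hx)
  rw [← h] at h1
  have h2 := nonpos_of_mul_nonpos_right h1 (jacobiWeight_pos hx)
  exact abs_eq_zero.1 (le_antisymm h2 (abs_nonneg _))

/-- Moving a polynomial `P` slightly towards `q` lowers its weighted sup norm when `q` agrees
with `P` at all points where the weighted maximum is attained. -/
lemma eventually_jacobiSup_sub_lt {ρa ρb : ℝ} (ha : 0 ≤ ρa) (hb : 0 ≤ ρb) {P q : Polynomial ℝ}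
    (hP : P ≠ 0)
    (hq : ∀ x ∈ Set.Icc (-1 : ℝ) 1, jacobiWeight ρa ρb x * |P.eval x| = jacobiSup ρa ρb P →
      q.eval x = P.eval x) :
    ∃ ε : ℝ, jacobiSup ρa ρb (P - Polynomial.C ε * q) < jacobiSup ρa ρb P := by
  set M := jacobiSup ρa ρb P with hM
  have hMpos : 0 < M := jacobiSup_pos ha hb hP
  have hw := continuous_jacobiWeight ha hb
  have key : ∀ᶠ ε : ℝ in nhds 0, ∀ x ∈ Set.Icc (-1 : ℝ) 1,
      0 < ε → jacobiWeight ρa ρb x * |P.eval x - ε * q.eval x| < M := by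
    have hfil : ∀ x ∈ Set.Icc (-1 : ℝ) 1, ∀ᶠ z : ℝ × ℝ in nhds ((0 : ℝ), x),
        z.2 ∈ Set.Icc (-1 : ℝ) 1 →
        0 < z.1 → jacobiWeight ρa ρb z.2 * |P.eval z.2 - z.1 * q.eval z.2| < M := by
      intro x hx
      have hPc : Continuous fun z : ℝ × ℝ => P.eval z.2 := P.continuous.comp continuous_snd
      have hqc : Continuous fun z : ℝ × ℝ => q.eval z.2 := q.continuous.comp continuous_snd
      have hwc : Continuous fun z : ℝ × ℝ => jacobiWeight ρa ρb z.2 := hw.comp continuous_snd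
      rcases (le_jacobiSup ha hb P hx).lt_or_eq with hlt | heq
      · have hc : Continuous fun z : ℝ × ℝ =>
            jacobiWeight ρa ρb z.2 * |P.eval z.2 - z.1 * q.eval z.2| :=
          hwc.mul (hPc.sub (continuous_fst.mul hqc)).abs
        have := (hc.tendsto ((0 : ℝ), x)).eventually_lt_const (u := M)
          (by simpa using hlt)
        filter_upwards [this] with z hz _ _ using hz
      · have hPq := hq x hx heq
        have hne : jacobiWeight ρa ρb x * |P.eval x| ≠ 0 := heq ▸ hMpos.ne'
        have hPx : P.eval x ≠ 0 := fun h => hne (by simp [h])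
        have hwx : 0 < jacobiWeight ρa ρb x :=
          (jacobiWeight_nonneg hx).lt_of_ne fun h => hne (by simp [← h])
        have e1 := (hwc.tendsto ((0 : ℝ), x)).eventually_const_lt (u := 0) hwx
        have hc : Continuous fun z : ℝ × ℝ =>
            z.1 * q.eval z.2 ^ 2 - 2 * (P.eval z.2 * q.eval z.2) :=
          (continuous_fst.mul (hqc.pow 2)).sub (continuous_const.mul (hPc.mul hqc))
        have e2 := (hc.tendsto ((0 : ℝ), x)).eventually_lt_const (u := 0)
          (by simp only [hPq]; nlinarith [sq_nonneg (P.eval x), mul_self_pos.2 hPx])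
        filter_upwards [e1, e2] with z h1 h2 hz hpos
        refine lt_of_lt_of_le (mul_lt_mul_of_pos_left ?_ h1) (le_jacobiSup ha hb P hz)
        refine sq_lt_sq.1 ?_
        nlinarith [mul_neg_of_pos_of_neg hpos h2]
    have := isCompact_Icc.eventually_forall_of_forall_eventually
      (P := fun (ε x : ℝ) => x ∈ Set.Icc (-1 : ℝ) 1 →
        0 < ε → jacobiWeight ρa ρb x * |P.eval x - ε * q.eval x| < M) hfil
    filter_upwards [this] with ε h x hx using h x hx hx
  obtain ⟨ε, hε, hpos⟩ := ((key.filter_mono nhdsWithin_le_nhds).and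
    (self_mem_nhdsWithin : Set.Ioi (0 : ℝ) ∈ nhdsWithin 0 (Set.Ioi 0))).exists
  refine ⟨ε, ?_⟩
  obtain ⟨x, hx, hmax⟩ := isCompact_Icc.exists_isMaxOn
    (Set.nonempty_Icc.2 (by norm_num : (-1 : ℝ) ≤ 1))
    (hw.mul (P - Polynomial.C ε * q).continuous.abs).continuousOn
  refine (jacobiSup_le fun y hy => hmax hy).trans_lt ?_
  simpa using hε x hx hpos

/-- The weighted maximum of a minimiser is attained at `n + 1` or more interior points. -/
lemma exists_extremal_points {ρa ρb : ℝ} (ha : 0 < ρa) (hb : 0 < ρb) {n : ℕ} {P : Polynomial ℝ}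
    (hP : P.Monic) (hn : P.natDegree = n)
    (hmin : ∀ R : Polynomial ℝ, R.Monic → R.natDegree = n →
      jacobiSup ρa ρb P ≤ jacobiSup ρa ρb R) :
    ∃ s : Finset ℝ, s.card = n + 1 ∧ ∀ x ∈ s, x ∈ Set.Ioo (-1 : ℝ) 1 ∧
      jacobiWeight ρa ρb x * |P.eval x| = jacobiSup ρa ρb P := by
  have hMpos : 0 < jacobiSup ρa ρb P := jacobiSup_pos ha.le hb.le hP.ne_zero
  set E : Set ℝ := {x | x ∈ Set.Icc (-1 : ℝ) 1 ∧
    jacobiWeight ρa ρb x * |P.eval x| = jacobiSup ρa ρb P} with hE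
  have hEint : ∀ x ∈ E, x ∈ Set.Ioo (-1 : ℝ) 1 := by
    rintro x ⟨hx, h⟩
    refine ⟨hx.1.lt_of_ne ?_, hx.2.lt_of_ne ?_⟩
    · rintro rfl
      simp [jacobiWeight, Real.zero_rpow hb.ne'] at h
      exact hMpos.ne h
    · rintro rfl
      simp [jacobiWeight, Real.zero_rpow ha.ne'] at h
      exact hMpos.ne h
  suffices h : ∃ s : Finset ℝ, s.card = n + 1 ∧ (s : Set ℝ) ⊆ E by
    obtain ⟨s, hs, hsE⟩ := h
    exact ⟨s, hs, fun x hx => ⟨hEint x (hsE hx), (hsE hx).2⟩⟩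
  by_cases hfin : E.Finite
  swap
  · obtain ⟨s, hs, hc⟩ := Set.Infinite.exists_subset_card_eq hfin (n + 1)
    exact ⟨s, hc, hs⟩
  by_cases hcard : n + 1 ≤ hfin.toFinset.card
  · obtain ⟨s, hs, hc⟩ := Finset.exists_subset_card_eq hcard
    exact ⟨s, hc, fun x hx => hfin.mem_toFinset.1 (hs hx)⟩
  exfalso
  set q := Lagrange.interpolate hfin.toFinset id fun x => P.eval x with hqdef
  have hqdeg : q.degree < n := by
    refine (Lagrange.degree_interpolate_lt _ (Set.injOn_id _)).trans_le ?_
    exact_mod_cast (by lia : hfin.toFinset.card ≤ n)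
  obtain ⟨ε, hε⟩ := eventually_jacobiSup_sub_lt ha.le hb.le (P := P) (q := q) hP.ne_zero
    fun x hx h => Lagrange.eval_interpolate_at_node (v := id) (fun x => P.eval x)
      (Set.injOn_id _) (hfin.mem_toFinset.2 ⟨hx, h⟩)
  have hdeg : P.degree = n := by rw [Polynomial.degree_eq_natDegree hP.ne_zero, hn]
  have hlt : (Polynomial.C ε * q).degree < P.degree :=
    ((Polynomial.C_mul' ε q).symm ▸ Polynomial.degree_smul_le ε q).trans_lt (hdeg ▸ hqdeg)
  refine absurd (hmin _ (hP.sub_of_left hlt) ?_) (not_le.2 hε)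
  refine Polynomial.natDegree_eq_of_degree_eq_some ?_
  rw [Polynomial.degree_sub_eq_left_of_degree_lt hlt, hdeg]

open Polynomial in
lemma coeff_X_mul_derivative (p : ℝ[X]) (k : ℕ) :
    (X * derivative p).coeff k = k * p.coeff k := by
  cases k with
  | zero => simp
  | succ k => rw [coeff_X_mul, coeff_derivative]; push_cast; ring

open Polynomial in
/-- The monic numerator of the derivative of `(1-x)^ρa (1+x)^ρb P(x)`. -/
lemma exists_monic_numerator {ρa ρb : ℝ} (ha : 0 < ρa) (hb : 0 < ρb) {n : ℕ} {P : ℝ[X]}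
    (hP : P.Monic) (hn : P.natDegree = n) :
    ∃ Q : ℝ[X], Q.Monic ∧ Q.natDegree = n + 1 ∧
      (1 - X ^ 2) * derivative P + (C ρb * (1 - X) - C ρa * (1 + X)) * P =
        -(C (n + ρa + ρb) * Q) := by
  have hL : (n + ρa + ρb : ℝ) ≠ 0 := by positivity
  set K : ℝ[X] := (1 - X ^ 2) * derivative P + (C ρb * (1 - X) - C ρa * (1 + X)) * P with hK
  have hcoeff : ∀ k : ℕ, K.coeff (k + 1) = (k + 2) * P.coeff (k + 2) - k * P.coeff k +
      (ρb - ρa) * P.coeff (k + 1) - (ρa + ρb) * P.coeff k := by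
    intro k
    have : K = derivative P - X * (X * derivative P) + C (ρb - ρa) * P -
        C (ρa + ρb) * (X * P) := by
      rw [hK]; simp only [map_sub, map_add]; ring
    rw [this]
    simp only [coeff_sub, coeff_add, coeff_C_mul, coeff_X_mul, coeff_X_mul_derivative,
      coeff_derivative]
    push_cast
    ring
  have hz : ∀ k, n < k → P.coeff k = 0 := fun k hk => coeff_eq_zero_of_natDegree_lt (hn ▸ hk)
  have hPn : P.coeff n = 1 := hn ▸ hP.coeff_natDegree
  have htop : (C (-(n + ρa + ρb : ℝ)⁻¹) * K).coeff (n + 1) = 1 := by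
    rw [coeff_C_mul, hcoeff, hz (n + 2) (by lia), hz (n + 1) (by lia), hPn]
    field_simp
    ring
  have hle : (C (-(n + ρa + ρb : ℝ)⁻¹) * K).natDegree ≤ n + 1 := by
    refine (natDegree_C_mul_le _ _).trans (natDegree_le_iff_coeff_eq_zero.2 fun N hN => ?_)
    obtain ⟨k, rfl⟩ : ∃ k, N = k + 1 := ⟨N - 1, by lia⟩
    rw [hcoeff, hz _ (by lia), hz _ (by lia), hz _ (by lia)]
    ring
  refine ⟨C (-(n + ρa + ρb : ℝ)⁻¹) * K, monic_of_natDegree_le_of_coeff_eq_one _ hle htop,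
    le_antisymm hle (le_natDegree_of_ne_zero (by rw [htop]; exact one_ne_zero)), ?_⟩
  rw [← mul_assoc, ← C_mul, mul_neg, mul_inv_cancel₀ hL]
  simp

open Polynomial in
/-- The cofactor of `Q` in the numerator of the derivative of the Bernstein–Szegő majorant. -/
noncomputable def majorantCofactor (ρa ρb L : ℝ) (P Q : ℝ[X]) : ℝ[X] :=
  (C ρb * (1 - X) - C ρa * (1 + X) + X) * Q - C L * ((1 - X ^ 2) * P) +
    (1 - X ^ 2) * derivative Q

open Polynomial in
lemma natDegree_majorantCofactor_le {ρa ρb : ℝ} {n : ℕ} {P Q : ℝ[X]}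
    (hP : P.Monic) (hn : P.natDegree = n) (hQ : Q.Monic) (hQn : Q.natDegree = n + 1) :
    (majorantCofactor ρa ρb (n + ρa + ρb) P Q).natDegree ≤ n + 1 := by
  have hcoeff : ∀ k : ℕ, (majorantCofactor ρa ρb (n + ρa + ρb) P Q).coeff (k + 2) =
      (ρb - ρa) * Q.coeff (k + 2) + (1 - ρa - ρb) * Q.coeff (k + 1)
        - (n + ρa + ρb) * (P.coeff (k + 2) - P.coeff k)
        + (k + 3) * Q.coeff (k + 3) - (k + 1) * Q.coeff (k + 1) := by
    intro k
    have : majorantCofactor ρa ρb (n + ρa + ρb) P Q = C (ρb - ρa) * Q +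
        C (1 - ρa - ρb) * (X * Q) - C (n + ρa + ρb) * (P - X * (X * P)) +
        derivative Q - X * (X * derivative Q) := by
      rw [majorantCofactor]; simp only [map_sub, map_add, map_one]; ring
    rw [this]
    simp only [coeff_sub, coeff_add, coeff_C_mul, coeff_X_mul, coeff_derivative]
    push_cast
    ring
  have hz : ∀ k, n < k → P.coeff k = 0 := fun k hk => coeff_eq_zero_of_natDegree_lt (hn ▸ hk)
  have hz' : ∀ k, n + 1 < k → Q.coeff k = 0 :=
    fun k hk => coeff_eq_zero_of_natDegree_lt (hQn ▸ hk)
  have hPn : P.coeff n = 1 := hn ▸ hP.coeff_natDegree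
  have hQ1 : Q.coeff (n + 1) = 1 := hQn ▸ hQ.coeff_natDegree
  refine natDegree_le_iff_coeff_eq_zero.2 fun N hN => ?_
  obtain ⟨k, rfl⟩ : ∃ k, N = k + 2 := ⟨N - 2, by lia⟩
  rw [hcoeff]
  rcases (by lia : n ≤ k).eq_or_lt with rfl | hk
  · rw [hz' (n + 2) (by lia), hz' (n + 3) (by lia), hz (n + 2) (by lia), hPn, hQ1]
    ring
  · rw [hz' (k + 2) (by lia), hz' (k + 3) (by lia), hz' (k + 1) (by lia), hz (k + 2) (by lia),
      hz k hk]
    ring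

open Polynomial in
/-- The majorant `(1-x)^{2ρa-1} (1+x)^{2ρb-1} ((1-x²) P² + Q²)`. -/
noncomputable def majorant (ρa ρb : ℝ) (P Q : ℝ[X]) (x : ℝ) : ℝ :=
  jacobiWeight (2 * ρa - 1) (2 * ρb - 1) x * ((1 - x ^ 2) * P.eval x ^ 2 + Q.eval x ^ 2)

open Polynomial in
lemma hasDerivAt_majorant {ρa ρb L : ℝ} {P Q : ℝ[X]}
    (hPQ : (1 - X ^ 2) * derivative P + (C ρb * (1 - X) - C ρa * (1 + X)) * P = -(C L * Q))
    {x : ℝ} (hx : x ∈ Set.Ioo (-1 : ℝ) 1) :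
    HasDerivAt (majorant ρa ρb P Q)
      (2 * jacobiWeight (2 * ρa - 1) (2 * ρb - 1) x / (1 - x ^ 2) *
        (Q.eval x * (majorantCofactor ρa ρb L P Q).eval x)) x := by
  have h3 : 1 - x ^ 2 ≠ 0 := by nlinarith [hx.1, hx.2]
  have hd := (hasDerivAt_jacobiWeight (2 * ρa - 1) (2 * ρb - 1) hx).mul
    (((((hasDerivAt_id x).pow 2).const_sub 1).mul ((P.hasDerivAt x).pow 2)).add
      ((Q.hasDerivAt x).pow 2))
  refine HasDerivAt.congr_deriv (f := majorant ρa ρb P Q) hd ?_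
  have he := congrArg (Polynomial.eval x) hPQ
  simp only [eval_add, eval_mul, eval_sub, eval_one, eval_pow, eval_X, eval_C, eval_neg] at he
  simp only [majorantCofactor, eval_add, eval_mul, eval_sub, eval_one, eval_pow, eval_X, eval_C,
    id, Pi.pow_apply, Pi.mul_apply, Pi.add_apply]
  field_simp
  set v := jacobiWeight (2 * ρa - 1) (2 * ρb - 1) x
  linear_combination 2 * v * (1 - x ^ 2) * P.eval x * he

lemma continuous_majorant {ρa ρb : ℝ} (ha : 1 / 2 ≤ ρa) (hb : 1 / 2 ≤ ρb)
    (P Q : Polynomial ℝ) : Continuous (majorant ρa ρb P Q) :=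
  (continuous_jacobiWeight (by linarith) (by linarith)).mul
    (((continuous_const.sub (continuous_id.pow 2)).mul (P.continuous.pow 2)).add
      (Q.continuous.pow 2))

open Polynomial in
/-- At an interior maximum of the weighted polynomial its derivative numerator vanishes. -/
lemma eval_numerator_eq_zero {ρa ρb L : ℝ} (hL : L ≠ 0) (ha : 0 ≤ ρa) (hb : 0 ≤ ρb) {P Q : ℝ[X]}
    (hPQ : (1 - X ^ 2) * derivative P + (C ρb * (1 - X) - C ρa * (1 + X)) * P = -(C L * Q))
    (hP : P ≠ 0) {x : ℝ} (hx : x ∈ Set.Ioo (-1 : ℝ) 1)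
    (hmax : jacobiWeight ρa ρb x * |P.eval x| = jacobiSup ρa ρb P) : Q.eval x = 0 := by
  have h3 : 1 - x ^ 2 ≠ 0 := by nlinarith [hx.1, hx.2]
  have hMpos : 0 < jacobiSup ρa ρb P := jacobiSup_pos ha hb hP
  have hloc : IsLocalMax (fun y => (jacobiWeight ρa ρb y * P.eval y) ^ 2) x := by
    filter_upwards [Ioo_mem_nhds hx.1 hx.2] with y hy
    have h1 := le_jacobiSup ha hb P (Set.Ioo_subset_Icc_self hy)
    rw [← hmax] at h1
    refine sq_le_sq.2 ?_
    rwa [abs_mul, abs_mul, abs_of_pos (jacobiWeight_pos hy), abs_of_pos (jacobiWeight_pos hx)]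
  have hd := ((hasDerivAt_jacobiWeight ρa ρb hx).mul (P.hasDerivAt x)).pow 2
  have h0 := hloc.hasDerivAt_eq_zero hd
  have hw := (jacobiWeight_pos (a := ρa) (b := ρb) hx).ne'
  have hPx : P.eval x ≠ 0 := fun h => hMpos.ne (by rw [← hmax, h]; simp)
  have he := congrArg (Polynomial.eval x) hPQ
  simp only [eval_add, eval_mul, eval_sub, eval_one, eval_pow, eval_X, eval_C, eval_neg] at he
  simp only [Pi.mul_apply, Nat.cast_ofNat, Nat.add_one_sub_one, pow_one] at h0
  field_simp at h0
  have h4 : jacobiWeight ρa ρb x ^ 2 * P.eval x * L * Q.eval x = 0 := by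
    linear_combination (-1 / 2) * h0 + jacobiWeight ρa ρb x ^ 2 * P.eval x * he
  simpa [hw, hPx, hL] using h4

lemma Polynomial.Monic.eq_prod_X_sub_C {n : ℕ} {Q : Polynomial ℝ} (hQ : Q.Monic)
    (hn : Q.natDegree = n) {x : ℕ → ℝ} (hinj : Set.InjOn x (Finset.range n))
    (hx : ∀ i < n, Q.eval (x i) = 0) :
    Q = ∏ i ∈ Finset.range n, (Polynomial.X - Polynomial.C (x i)) := by
  have hdvd : ∏ i ∈ Finset.range n, (Polynomial.X - Polynomial.C (x i)) ∣ Q := by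
    refine Finset.prod_dvd_of_coprime (fun i hi j hj hij => ?_) fun i hi => ?_
    · exact Polynomial.isCoprime_X_sub_C_of_isUnit_sub
        (sub_ne_zero.2 fun h => hij (hinj hi hj h)).isUnit
    · exact Polynomial.dvd_iff_isRoot.2 (hx i (Finset.mem_range.1 hi))
  refine Polynomial.eq_of_monic_of_dvd_of_natDegree_le
    (Polynomial.monic_prod_of_monic _ _ fun i _ => Polynomial.monic_X_sub_C _) hQ hdvd ?_
  rw [hn, Polynomial.natDegree_prod_of_monic _ _ fun i _ => Polynomial.monic_X_sub_C _]
  simp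

/-- A function whose derivative is a positive multiple of `Q * R`, with the zeros of `Q` at the
nodes `x i` where the function takes one common value `c`, and with `R` having at most one zero
not forced by Rolle's theorem, is bounded by `c`. -/
lemma le_of_deriv_factor {n : ℕ} {x : ℕ → ℝ} {S g : ℝ → ℝ} {Q R : Polynomial ℝ} {c c₁ c₂ : ℝ}
    (hlt : ∀ i j, i < j → j ≤ n → x i < x j) (hxI : ∀ i ≤ n, x i ∈ Set.Ioo (-1 : ℝ) 1)
    (hQ : Q.Monic) (hQn : Q.natDegree = n + 1) (hQx : ∀ i ≤ n, Q.eval (x i) = 0)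
    (hR : R.natDegree ≤ n + 1) (hSx : ∀ i ≤ n, S (x i) = c) (hS : Continuous S)
    (hg : ∀ t ∈ Set.Ioo (-1 : ℝ) 1, 0 < g t)
    (hd : ∀ t ∈ Set.Ioo (-1 : ℝ) 1, HasDerivAt S (g t * (Q.eval t * R.eval t)) t)
    (hc₁ : 0 ≤ c₁) (hc₂ : 0 ≤ c₂) (hR1 : R.eval 1 = -c₁ * Q.eval 1)
    (hR2 : R.eval (-1) = c₂ * Q.eval (-1)) {t : ℝ} (ht : t ∈ Set.Icc (-1 : ℝ) 1) : S t ≤ c := by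
  have hle : ∀ i j, i ≤ j → j ≤ n → x i ≤ x j := fun i j hij hj =>
    hij.eq_or_lt.elim (fun h => h ▸ le_rfl) fun h => (hlt i j h hj).le
  have hinj : Set.InjOn x (Finset.range (n + 1)) := by
    intro i hi j hj hij
    simp only [Finset.coe_range, Set.mem_Iio] at hi hj
    rcases lt_trichotomy i j with h | h | h
    · exact absurd hij (hlt i j h (by lia)).ne
    · exact h
    · exact absurd hij (hlt j i h (by lia)).ne'
  have hQprod := hQ.eq_prod_X_sub_C hQn hinj fun i hi => hQx i (by lia)
  have hQeval : ∀ t, Q.eval t = ∏ i ∈ Finset.range (n + 1), (t - x i) := by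
    intro t
    rw [hQprod, Polynomial.eval_prod]
    simp
  have hrolle : ∀ i, ∃ y, i < n → x i < y ∧ y < x (i + 1) ∧ R.eval y = 0 := by
    intro i
    by_cases hi : i < n
    swap
    · exact ⟨0, fun h => absurd h hi⟩
    have hsub : ∀ y ∈ Set.Ioo (x i) (x (i + 1)), y ∈ Set.Ioo (-1 : ℝ) 1 := fun y hy =>
      ⟨(hxI i (by lia)).1.trans hy.1, hy.2.trans (hxI (i + 1) (by lia)).2⟩
    obtain ⟨y, hy, h0⟩ := exists_hasDerivAt_eq_zero (hlt i (i + 1) (by lia) (by lia))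
      hS.continuousOn (by rw [hSx i (by lia), hSx (i + 1) (by lia)]) fun y hy => hd y (hsub y hy)
    refine ⟨y, fun _ => ⟨hy.1, hy.2, ?_⟩⟩
    have hQy : Q.eval y ≠ 0 := by
      rw [hQeval]
      refine Finset.prod_ne_zero_iff.2 fun k hk => sub_ne_zero.2 ?_
      rcases (by lia : k ≤ i ∨ i + 1 ≤ k) with h | h
      · exact ((hle k i h (by lia)).trans_lt hy.1).ne'
      · exact (hy.2.trans_le (hle (i + 1) k h (by have := Finset.mem_range.1 hk; lia))).ne
    simpa [(hg y (hsub y hy)).ne', hQy] using h0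
  choose y hy using hrolle
  have hylt : ∀ i j, i < j → j < n → y i < y j := fun i j hij hj =>
    ((hy i (by lia)).2.1.trans_le (hle (i + 1) j (by lia) (by lia))).trans (hy j hj).1
  set D : Polynomial ℝ := ∏ i ∈ Finset.range n, (Polynomial.X - Polynomial.C (y i)) with hD
  have hDmonic : D.Monic :=
    Polynomial.monic_prod_of_monic _ _ fun i _ => Polynomial.monic_X_sub_C _
  have hDdeg : D.natDegree = n := by
    rw [hD, Polynomial.natDegree_prod_of_monic _ _ fun i _ => Polynomial.monic_X_sub_C _]
    simp
  have hDeval : ∀ t, D.eval t = ∏ i ∈ Finset.range n, (t - y i) := by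
    intro t
    rw [hD, Polynomial.eval_prod]
    simp
  obtain ⟨l, hl⟩ : D ∣ R := by
    refine Finset.prod_dvd_of_coprime (fun i hi j hj hij => ?_) fun i hi => ?_
    · simp only [Finset.coe_range, Set.mem_Iio] at hi hj
      refine Polynomial.isCoprime_X_sub_C_of_isUnit_sub (sub_ne_zero.2 ?_).isUnit
      rcases lt_or_gt_of_ne hij with h | h
      · exact (hylt i j h hj).ne
      · exact (hylt j i h hi).ne'
    · exact Polynomial.dvd_iff_isRoot.2 (hy i (Finset.mem_range.1 hi)).2.2
  have hldeg : l.natDegree ≤ 1 := by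
    by_cases h0 : l = 0
    · simp [h0]
    · rw [hl, hDmonic.natDegree_mul' h0, hDdeg] at hR
      lia
  -- the sign of `Q * D`
  have hQDnonneg : ∀ t, x 0 ≤ t → (∀ i < n, 0 ≤ (t - x (i + 1)) * (t - y i)) →
      0 ≤ Q.eval t * D.eval t := by
    intro t h0 h
    rw [hQeval, hDeval, Finset.prod_range_succ', mul_right_comm, ← Finset.prod_mul_distrib]
    exact mul_nonneg (Finset.prod_nonneg fun i hi => h i (Finset.mem_range.1 hi))
      (sub_nonneg.2 h0)
  have hQDnonpos : ∀ t, t ≤ x n → (∀ i < n, 0 ≤ (t - x i) * (t - y i)) →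
      Q.eval t * D.eval t ≤ 0 := by
    intro t h0 h
    rw [hQeval, hDeval, Finset.prod_range_succ, mul_right_comm, ← Finset.prod_mul_distrib]
    exact mul_nonpos_of_nonneg_of_nonpos
      (Finset.prod_nonneg fun i hi => h i (Finset.mem_range.1 hi)) (sub_nonpos.2 h0)
  have hyI : ∀ i < n, y i ∈ Set.Ioo (-1 : ℝ) 1 := fun i hi =>
    ⟨(hxI i (by lia)).1.trans (hy i hi).1, (hy i hi).2.1.trans (hxI (i + 1) (by lia)).2⟩
  -- the remaining linear factor is nonpositive
  have hl1 : l.eval 1 ≤ 0 := by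
    have hne : D.eval 1 ≠ 0 := by
      rw [hDeval]
      exact Finset.prod_ne_zero_iff.2 fun i hi =>
        sub_ne_zero.2 (hyI i (Finset.mem_range.1 hi)).2.ne'
    have h1 := hQDnonneg 1 (hxI 0 (by lia)).2.le fun i hi => mul_nonneg
      (sub_nonneg.2 (hxI (i + 1) (by lia)).2.le) (sub_nonneg.2 (hyI i hi).2.le)
    have h2 : D.eval 1 ^ 2 * l.eval 1 = -c₁ * (Q.eval 1 * D.eval 1) := by
      rw [hl, Polynomial.eval_mul] at hR1
      linear_combination D.eval 1 * hR1
    have h3 : 0 < D.eval 1 ^ 2 := by positivity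
    by_contra! hcon
    nlinarith [mul_pos h3 hcon, mul_nonneg hc₁ h1]
  have hl2 : l.eval (-1) ≤ 0 := by
    have hne : D.eval (-1) ≠ 0 := by
      rw [hDeval]
      exact Finset.prod_ne_zero_iff.2 fun i hi =>
        sub_ne_zero.2 (hyI i (Finset.mem_range.1 hi)).1.ne
    have h1 := hQDnonpos (-1) (hxI n le_rfl).1.le fun i hi => mul_nonneg_of_nonpos_of_nonpos
      (sub_nonpos.2 (hxI i hi.le).1.le) (sub_nonpos.2 (hyI i hi).1.le)
    have h2 : D.eval (-1) ^ 2 * l.eval (-1) = c₂ * (Q.eval (-1) * D.eval (-1)) := by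
      rw [hl, Polynomial.eval_mul] at hR2
      linear_combination D.eval (-1) * hR2
    have h3 : 0 < D.eval (-1) ^ 2 := by positivity
    by_contra! hcon
    nlinarith [mul_pos h3 hcon, mul_nonneg hc₂ (neg_nonneg.2 h1)]
  have hlneg : ∀ t ∈ Set.Icc (-1 : ℝ) 1, l.eval t ≤ 0 := by
    intro t ht
    obtain ⟨p, q, rfl⟩ := Polynomial.exists_eq_X_add_C_of_natDegree_le_one hldeg
    simp only [Polynomial.eval_add, Polynomial.eval_mul, Polynomial.eval_C, Polynomial.eval_X]
      at hl1 hl2 ⊢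
    nlinarith [ht.1, ht.2]
  have hcofactor : ∀ t, Q.eval t * R.eval t = Q.eval t * D.eval t * l.eval t := by
    intro t
    rw [hl, Polynomial.eval_mul, mul_assoc]
  -- the function is bounded to the right and to the left of each node
  have hright : ∀ j ≤ n, ∀ t, x j ≤ t → t ≤ 1 → (j < n → t ≤ y j) → S t ≤ c := by
    intro j hj t h1 h2 h3
    rw [← hSx j hj]
    refine antitoneOn_of_hasDerivWithinAt_nonpos (convex_Icc (x j) t) hS.continuousOn
      (fun s hs => (hd s ?_).hasDerivWithinAt) (fun s hs => ?_) (Set.left_mem_Icc.2 h1)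
      (Set.right_mem_Icc.2 h1) h1
    all_goals
      rw [interior_Icc] at hs
      have hs' : s ∈ Set.Ioo (-1 : ℝ) 1 := ⟨(hxI j hj).1.trans hs.1, hs.2.trans_le h2⟩
    · exact hs'
    · rw [hcofactor]
      refine mul_nonpos_of_nonneg_of_nonpos (hg s hs').le (mul_nonpos_of_nonneg_of_nonpos
        (hQDnonneg s ((hle 0 j (by lia) hj).trans hs.1.le) fun i hi => ?_)
        (hlneg s ⟨hs'.1.le, hs'.2.le⟩))
      rcases lt_or_ge i j with hij | hij
      · have h4 := (hle (i + 1) j hij hj).trans hs.1.le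
        exact mul_nonneg (sub_nonneg.2 h4) (sub_nonneg.2 ((hy i hi).2.1.le.trans h4))
      · have h4 : s ≤ y i := by
          have h5 := hs.2.le.trans (h3 (by lia))
          rcases hij.eq_or_lt with rfl | h6
          · exact h5
          · exact h5.trans (hylt j i h6 hi).le
        exact mul_nonneg_of_nonpos_of_nonpos (sub_nonpos.2 (h4.trans (hy i hi).2.1.le))
          (sub_nonpos.2 h4)
  have hleft : ∀ j ≤ n, ∀ t, t ≤ x j → -1 ≤ t → (∀ k < n, j = k + 1 → y k ≤ t) → S t ≤ c := by
    intro j hj t h1 h2 h3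
    rw [← hSx j hj]
    refine monotoneOn_of_hasDerivWithinAt_nonneg (convex_Icc t (x j)) hS.continuousOn
      (fun s hs => (hd s ?_).hasDerivWithinAt) (fun s hs => ?_) (Set.left_mem_Icc.2 h1)
      (Set.right_mem_Icc.2 h1) h1
    all_goals
      rw [interior_Icc] at hs
      have hs' : s ∈ Set.Ioo (-1 : ℝ) 1 := ⟨h2.trans_lt hs.1, hs.2.trans (hxI j hj).2⟩
    · exact hs'
    · rw [hcofactor]
      refine mul_nonneg (hg s hs').le (mul_nonneg_of_nonpos_of_nonpos
        (hQDnonpos s (hs.2.le.trans (hle j n hj le_rfl)) fun i hi => ?_)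
        (hlneg s ⟨hs'.1.le, hs'.2.le⟩))
      rcases lt_or_ge i j with hij | hij
      · have h4 : y i ≤ s := by
          obtain ⟨k, rfl⟩ : ∃ k, j = k + 1 := ⟨j - 1, by lia⟩
          have h5 := (h3 k (by lia) rfl).trans hs.1.le
          rcases (by lia : i ≤ k).eq_or_lt with rfl | h6
          · exact h5
          · exact (hylt i k h6 (by lia)).le.trans h5
        exact mul_nonneg (sub_nonneg.2 ((hy i hi).1.le.trans h4)) (sub_nonneg.2 h4)
      · have h4 := hs.2.le.trans (hle j i hij hi.le)
        exact mul_nonneg_of_nonpos_of_nonpos (sub_nonpos.2 h4)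
          (sub_nonpos.2 (h4.trans (hy i hi).1.le))
  rcases le_or_gt t (x 0) with h0 | h0
  · exact hleft 0 (by lia) t h0 ht.1 (by simp)
  have hex : ∃ j ≤ n, x j ≤ t ∧ (j < n → t ≤ x (j + 1)) := by
    let p := fun j => x j ≤ t
    classical
    refine ⟨Nat.findGreatest p n, Nat.findGreatest_le n, Nat.findGreatest_spec (P := p)
      (Nat.zero_le n) h0.le, fun h => ?_⟩
    exact (not_le.1 (Nat.findGreatest_is_greatest (P := p) (Nat.lt_succ_self _) h)).le
  obtain ⟨j, hj, hjt, hj'⟩ := hex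
  by_cases hyt : j < n → t ≤ y j
  · exact hright j hj t hjt ht.2 hyt
  · push Not at hyt
    refine hleft (j + 1) hyt.1 t (hj' hyt.1) ht.1 fun k _ hk => ?_
    obtain rfl : j = k := by lia
    exact hyt.2.le

open Polynomial in
/-- A Bernstein–Szegő inequality for extremal polynomials. -/
lemma exists_extremal_majorant {ρa ρb : ℝ} (ha : 1 / 2 ≤ ρa) (hb : 1 / 2 ≤ ρb) (n : ℕ) :
    ∃ (P Q : ℝ[X]) (M : ℝ), P.Monic ∧ P.natDegree = n ∧ Q.Monic ∧ Q.natDegree = n + 1 ∧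
      0 ≤ M ∧ widomFactor ρa ρb n = 2 ^ n * M ∧
      ∀ x ∈ Set.Icc (-1 : ℝ) 1, majorant ρa ρb P Q x ≤ M ^ 2 := by
  have ha0 : 0 < ρa := by linarith
  have hb0 : 0 < ρb := by linarith
  obtain ⟨P, hP, hn, hmin⟩ := exists_minimizer ha0.le hb0.le n
  obtain ⟨Q, hQ, hQn, hPQ⟩ := exists_monic_numerator ha0 hb0 hP hn
  obtain ⟨s, hs, hsP⟩ := exists_extremal_points ha0 hb0 hP hn hmin
  have hL : (n + ρa + ρb : ℝ) ≠ 0 := by positivity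
  refine ⟨P, Q, jacobiSup ρa ρb P, hP, hn, hQ, hQn, jacobiSup_nonneg ha0.le hb0.le P, ?_, ?_⟩
  · rw [widomFactor]
    congr 1
    refine IsLeast.csInf_eq ⟨⟨P, ⟨hP, hn⟩, rfl⟩, ?_⟩
    rintro _ ⟨R, ⟨hR, hRn⟩, rfl⟩
    exact hmin R hR hRn
  let x : ℕ → ℝ := fun i => if h : i < n + 1 then s.orderEmbOfFin hs ⟨i, h⟩ else 0
  have hx : ∀ i (h : i ≤ n), x i = s.orderEmbOfFin hs ⟨i, Nat.lt_succ_of_le h⟩ :=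
    fun i h => dif_pos (Nat.lt_succ_of_le h)
  have hxs : ∀ i ≤ n, x i ∈ s := fun i h => by
    rw [hx i h]
    exact Finset.orderEmbOfFin_mem s hs _
  have hlt : ∀ i j, i < j → j ≤ n → x i < x j := fun i j hij hj => by
    rw [hx i (by lia), hx j hj]
    exact (s.orderEmbOfFin hs).strictMono hij
  have hQx : ∀ i ≤ n, Q.eval (x i) = 0 := fun i hi =>
    eval_numerator_eq_zero hL ha0.le hb0.le hPQ hP.ne_zero (hsP _ (hxs i hi)).1
      (hsP _ (hxs i hi)).2
  intro t ht
  refine le_of_deriv_factor (c₁ := 2 * ρa - 1) (c₂ := 2 * ρb - 1) hlt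
    (fun i hi => (hsP _ (hxs i hi)).1) hQ hQn hQx
    (natDegree_majorantCofactor_le (ρa := ρa) (ρb := ρb) hP hn hQ hQn) (fun i hi => ?_)
    (continuous_majorant ha hb P Q) (fun t ht => ?_) (fun t ht => hasDerivAt_majorant hPQ ht)
    (by linarith) (by linarith) ?_ ?_ ht
  · obtain ⟨h1, h2⟩ := hsP _ (hxs i hi)
    rw [← h2, mul_pow, sq_abs, jacobiWeight_sq ha hb (Set.Ioo_subset_Icc_self h1), majorant,
      hQx i hi]
    ring
  · exact div_pos (mul_pos two_pos (jacobiWeight_pos ht)) (by nlinarith [ht.1, ht.2])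
  · simp only [majorantCofactor, eval_add, eval_mul, eval_sub, eval_one, eval_pow, eval_X, eval_C]
    ring
  · simp only [majorantCofactor, eval_add, eval_mul, eval_sub, eval_one, eval_pow, eval_X, eval_C]
    ring

open Polynomial in
lemma antitone_widomFactor {ρa ρb : ℝ} (ha : 1 / 2 ≤ ρa) (hb : 1 / 2 ≤ ρb) :
    Antitone (widomFactor ρa ρb) := by
  refine antitone_nat_of_succ_le fun n => ?_
  obtain ⟨P, Q, M, hP, hn, hQ, hQn, hM, hW, hmaj⟩ := exists_extremal_majorant ha hb n
  have hXP : (X * P).natDegree = n + 1 := by rw [natDegree_X_mul hP.ne_zero, hn]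
  have hXPm : (X * P).Monic := monic_X.mul hP
  have htop : (C (1 / 2 : ℝ) * (X * P + Q)).coeff (n + 1) = 1 := by
    have h1 : (X * P).coeff (n + 1) = 1 := hXP ▸ hXPm.coeff_natDegree
    have h2 : Q.coeff (n + 1) = 1 := hQn ▸ hQ.coeff_natDegree
    rw [coeff_C_mul, coeff_add, h1, h2]
    norm_num
  have hle : (C (1 / 2 : ℝ) * (X * P + Q)).natDegree ≤ n + 1 :=
    (natDegree_C_mul_le _ _).trans (natDegree_add_le_of_degree_le hXP.le hQn.le)
  have hbound := widomFactor_le (ρa := ρa) (ρb := ρb) (C := M / 2) (n := n + 1)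
    (by linarith) (by linarith) (monic_of_natDegree_le_of_coeff_eq_one _ hle htop)
    (le_antisymm hle (le_natDegree_of_ne_zero (by rw [htop]; exact one_ne_zero)))
    (fun x hx => by
      refine abs_le_of_sq_le_sq' ?_ (by positivity) |>.2
      have h1 := hmaj x hx
      have h2 : 0 ≤ jacobiWeight (2 * ρa - 1) (2 * ρb - 1) x := jacobiWeight_nonneg hx
      rw [mul_pow, sq_abs, jacobiWeight_sq ha hb hx]
      simp only [eval_mul, eval_add, eval_C, eval_X]
      rw [majorant] at h1
      nlinarith [mul_nonneg h2 (sq_nonneg ((1 - x ^ 2) * P.eval x - x * Q.eval x))])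
  rw [hW]
  refine hbound.trans (le_of_eq ?_)
  ring

lemma widomFactor_zero_le {ρa ρb : ℝ} (ha : 0 < ρa) (hb : 0 < ρb) :
    widomFactor ρa ρb 0 ≤ (2 * ρa / (ρa + ρb)) ^ ρa * (2 * ρb / (ρa + ρb)) ^ ρb := by
  have hs : 0 < ρa + ρb := by positivity
  refine (widomFactor_le ha.le hb.le Polynomial.monic_one Polynomial.natDegree_one
    fun x hx => ?_).trans_eq (by rw [pow_zero, one_mul])
  rw [Polynomial.eval_one, abs_one, mul_one, jacobiWeight]
  have hA : 0 < 2 * ρa / (ρa + ρb) := by positivity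
  have hB : 0 < 2 * ρb / (ρa + ρb) := by positivity
  have h1 : 0 ≤ 1 - x := by linarith [hx.2]
  have h2 : 0 ≤ 1 + x := by linarith [hx.1]
  have hag := Real.geom_mean_le_arith_mean2_weighted (w₁ := ρa / (ρa + ρb))
    (w₂ := ρb / (ρa + ρb)) (p₁ := (1 - x) / (2 * ρa / (ρa + ρb)))
    (p₂ := (1 + x) / (2 * ρb / (ρa + ρb))) (by positivity) (by positivity) (by positivity)
    (by positivity) (by field_simp)
  have heq : ρa / (ρa + ρb) * ((1 - x) / (2 * ρa / (ρa + ρb))) +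
      ρb / (ρa + ρb) * ((1 + x) / (2 * ρb / (ρa + ρb))) = 1 := by
    field_simp
    ring
  rw [heq] at hag
  have hpow := Real.rpow_le_rpow (by positivity) hag hs.le
  rw [Real.one_rpow, Real.mul_rpow (by positivity) (by positivity),
    ← Real.rpow_mul (by positivity), ← Real.rpow_mul (by positivity),
    div_mul_cancel₀ _ hs.ne', div_mul_cancel₀ _ hs.ne', Real.div_rpow h1 hA.le,
    Real.div_rpow h2 hB.le, div_mul_div_comm] at hpow
  exact (div_le_one (by positivity)).1 hpow

lemma sq_norm_one_sub {z : ℂ} (hz : ‖z‖ = 1) : ‖1 - z‖ ^ 2 = 2 * (1 - z.re) := by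
  have h : z.re * z.re + z.im * z.im = 1 := by
    rw [← Complex.normSq_apply, Complex.normSq_eq_norm_sq, hz]; norm_num
  rw [← Complex.normSq_eq_norm_sq, Complex.normSq_apply]
  simp only [Complex.sub_re, Complex.sub_im, Complex.one_re, Complex.one_im]
  linear_combination h

lemma sq_norm_one_add {z : ℂ} (hz : ‖z‖ = 1) : ‖1 + z‖ ^ 2 = 2 * (1 + z.re) := by
  have := sq_norm_one_sub (z := -z) (by rwa [norm_neg])
  simpa using this

lemma re_mem_Icc_of_norm_eq_one {z : ℂ} (hz : ‖z‖ = 1) : z.re ∈ Set.Icc (-1 : ℝ) 1 :=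
  abs_le.mp (hz ▸ Complex.abs_re_le_norm z)

/-- The Jacobi weight lifted to the unit circle. -/
lemma sq_circle_weight (s t : ℝ) {z : ℂ} (hz : ‖z‖ = 1) :
    (‖1 - z‖ ^ s * ‖1 + z‖ ^ t) ^ 2 = 2 ^ (s + t) * jacobiWeight s t z.re := by
  have hx := re_mem_Icc_of_norm_eq_one hz
  have key : ∀ (w : ℂ) (r : ℝ), (‖w‖ ^ r) ^ 2 = (‖w‖ ^ 2) ^ r := fun w r => by
    rw [← Real.rpow_natCast, ← Real.rpow_mul (norm_nonneg _), mul_comm,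
      Real.rpow_mul (norm_nonneg _), Real.rpow_natCast]
  rw [mul_pow, key, key, sq_norm_one_sub hz, sq_norm_one_add hz,
    Real.mul_rpow (by norm_num) (by linarith [hx.2]),
    Real.mul_rpow (by norm_num) (by linarith [hx.1]), Real.rpow_add (by norm_num), jacobiWeight]
  ring

open Polynomial in
/-- `z ^ N * Q ((z + z⁻¹) / 2)`, written as a polynomial expression in `z`. -/
noncomputable def joukowskiLift (Q : ℝ[X]) (N : ℕ) (z : ℂ) : ℂ :=
  ∑ k ∈ Finset.range (N + 1), (Q.coeff k : ℂ) * (((z ^ 2 + 1) / 2) ^ k * z ^ (N - k))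

open Polynomial in
lemma differentiable_joukowskiLift (Q : ℝ[X]) (N : ℕ) :
    Differentiable ℂ (joukowskiLift Q N) := by
  unfold joukowskiLift
  fun_prop

open Polynomial in
lemma joukowskiLift_zero (Q : ℝ[X]) (N : ℕ) :
    joukowskiLift Q N 0 = (Q.coeff N : ℂ) * (1 / 2) ^ N := by
  unfold joukowskiLift
  rw [Finset.sum_range_succ, Finset.sum_eq_zero]
  · simp
  · intro k hk
    have : N - k ≠ 0 := by have := Finset.mem_range.mp hk; omega
    simp [this]

open Polynomial in
lemma joukowskiLift_eq {Q : ℝ[X]} {N : ℕ} (hQ : Q.natDegree ≤ N) {z : ℂ} (hz : ‖z‖ = 1) :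
    joukowskiLift Q N z = z ^ N * (Q.eval z.re : ℝ) := by
  have h0 : z ≠ 0 := by rintro rfl; simp at hz
  have hx : (z ^ 2 + 1) / 2 = z * (z.re : ℂ) := by
    have h1 : z * (starRingEnd ℂ) z = 1 := by
      rw [Complex.mul_conj, Complex.normSq_eq_norm_sq, hz]; norm_num
    rw [Complex.re_eq_add_conj]
    linear_combination -h1 / 2
  rw [eval_eq_sum_range' (Nat.lt_succ_of_le hQ), joukowskiLift, Complex.ofReal_sum,
    Finset.mul_sum]
  refine Finset.sum_congr rfl fun k hk => ?_
  have hk' : k ≤ N := Nat.lt_succ_iff.mp (Finset.mem_range.mp hk)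
  rw [hx, mul_pow]
  push_cast
  have : z ^ N = z ^ k * z ^ (N - k) := by rw [← pow_add]; congr 1; omega
  rw [this]; ring

lemma continuousAt_cpow_ofReal {s : ℝ} (hs : 0 ≤ s) {w : ℂ} (hw : 0 ≤ w.re)
    (hw' : w.re = 0 → w = 0) : ContinuousAt (fun z : ℂ => z ^ (s : ℂ)) w := by
  rcases hs.eq_or_lt with rfl | hs
  · simpa using continuousAt_const
  rcases eq_or_ne w 0 with rfl | h
  · have := Complex.continuousAt_cpow_zero_of_re_pos (z := (s : ℂ)) (by simpa using hs)
    exact ContinuousAt.comp (f := fun z : ℂ => (z, (s : ℂ))) this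
      (continuousAt_id.prodMk continuousAt_const)
  · exact continuousAt_cpow_const (Or.inl (hw.lt_of_ne fun h' => h (hw' h'.symm)))

lemma diffContOnCl_one_add_mul_cpow {s : ℝ} (hs : 0 ≤ s) {c : ℂ} (hc : ‖c‖ = 1) :
    DiffContOnCl ℂ (fun z : ℂ => (1 + c * z) ^ (s : ℂ)) (Metric.ball 0 1) := by
  constructor
  · intro z hz
    refine DifferentiableAt.differentiableWithinAt ?_
    refine DifferentiableAt.cpow_const (by fun_prop) ?_
    refine Complex.mem_slitPlane_of_norm_lt_one ?_
    rw [norm_mul, hc, one_mul]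
    simpa using hz
  · rw [closure_ball _ one_ne_zero]
    intro z hz
    have hz1 : ‖c * z‖ ≤ 1 := by rw [norm_mul, hc, one_mul]; simpa using hz
    have h1 := (abs_le.mp ((Complex.abs_re_le_norm (c * z)).trans hz1)).1
    refine ContinuousAt.continuousWithinAt ?_
    refine ContinuousAt.comp (g := fun w : ℂ => w ^ (s : ℂ)) (f := fun z : ℂ => 1 + c * z)
      (continuousAt_cpow_ofReal hs ?_ ?_) (by fun_prop)
    · rw [Complex.add_re, Complex.one_re]; linarith
    · intro h
      rw [Complex.add_re, Complex.one_re] at h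
      have h2 : (c * z).re * (c * z).re + (c * z).im * (c * z).im ≤ 1 := by
        rw [← Complex.normSq_apply, Complex.normSq_eq_norm_sq]
        exact pow_le_one₀ (norm_nonneg _) hz1
      have h3 : (c * z).re = -1 := by linarith
      rw [h3] at h2
      have h4 : (c * z).im = 0 := by nlinarith
      apply Complex.ext
      · rw [Complex.add_re, Complex.one_re, h]; rfl
      · rw [Complex.add_im, Complex.one_im, h4]; simp

lemma le_widomFactor {ρa ρb : ℝ} (ha : 1 / 2 ≤ ρa) (hb : 1 / 2 ≤ ρb) (n : ℕ) :
    (2 : ℝ) ^ (1 - ρa - ρb) ≤ widomFactor ρa ρb n := by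
  obtain ⟨P, Q, M, hP, hPn, hQ, hQn, hM, hW, hmaj⟩ := exists_extremal_majorant ha hb n
  set s := 2 * ρa - 1 with hs
  set t := 2 * ρb - 1 with ht
  set B : ℂ → ℂ := fun z => joukowskiLift Q (n + 1) z - (z ^ 2 - 1) / 2 * joukowskiLift P n z
  have hBd : Differentiable ℂ B := by
    have := differentiable_joukowskiLift Q (n + 1)
    have := differentiable_joukowskiLift P n
    fun_prop
  have hB0 : B 0 = ((1 / 2 : ℝ) ^ n : ℝ) := by
    have h1 : Q.coeff (n + 1) = 1 := hQn ▸ hQ.coeff_natDegree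
    have h2 : P.coeff n = 1 := hPn ▸ hP.coeff_natDegree
    simp only [B, joukowskiLift_zero, h1, h2]
    push_cast
    ring
  have hBn : ∀ z : ℂ, ‖z‖ = 1 →
      ‖B z‖ ^ 2 = (1 - z.re ^ 2) * P.eval z.re ^ 2 + Q.eval z.re ^ 2 := by
    intro z hz
    have h : z.re * z.re + z.im * z.im = 1 := by
      rw [← Complex.normSq_apply, Complex.normSq_eq_norm_sq, hz]; norm_num
    have h1 : (z ^ 2 - 1) / 2 = z * (z.im * Complex.I) := by
      have h1 : z * (starRingEnd ℂ) z = 1 := by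
        rw [Complex.mul_conj, Complex.normSq_eq_norm_sq, hz]; norm_num
      rw [Complex.im_eq_sub_conj]
      field_simp
      linear_combination h1
    have h2 : B z = z ^ (n + 1) * (⟨Q.eval z.re, -(z.im * P.eval z.re)⟩ : ℂ) := by
      have e : (⟨Q.eval z.re, -(z.im * P.eval z.re)⟩ : ℂ) =
          (Q.eval z.re : ℝ) - (z.im * Complex.I) * (P.eval z.re : ℝ) := by
        apply Complex.ext <;> simp
      simp only [B]
      rw [joukowskiLift_eq hQn.le hz, joukowskiLift_eq hPn.le hz, h1, e]
      ring
    rw [h2, norm_mul, norm_pow, hz, one_pow, one_mul, ← Complex.normSq_eq_norm_sq,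
      Complex.normSq_apply]
    simp only
    linear_combination (P.eval z.re) ^ 2 * h
  have hs0 : 0 ≤ s := by linarith
  have ht0 : 0 ≤ t := by linarith
  have hd : DiffContOnCl ℂ
      (fun z : ℂ => (1 + -1 * z) ^ (s : ℂ) * (1 + 1 * z) ^ (t : ℂ) * B z) (Metric.ball 0 1) := by
    have h1 := diffContOnCl_one_add_mul_cpow hs0 (c := -1) (by simp)
    have h2 := diffContOnCl_one_add_mul_cpow ht0 (c := 1) (by simp)
    simpa only [smul_eq_mul] using (h1.smul h2).smul hBd.diffContOnCl
  have hexp : (2 : ℝ) ^ (s + t) = (2 ^ (ρa + ρb - 1)) ^ 2 := by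
    rw [← Real.rpow_natCast, ← Real.rpow_mul (by norm_num)]
    congr 1; push_cast; rw [hs, ht]; ring
  have hbound := Complex.norm_le_of_forall_mem_frontier_norm_le Metric.isBounded_ball hd
    (C := 2 ^ (ρa + ρb - 1) * M) (z := 0) ?_ (subset_closure (by simp))
  · simp only [mul_zero, add_zero, Complex.one_cpow, one_mul, hB0, Complex.norm_real] at hbound
    rw [Real.norm_of_nonneg (by positivity)] at hbound
    have h2 : (2 : ℝ) ^ (1 - ρa - ρb) * 2 ^ (ρa + ρb - 1) = 1 := by
      rw [← Real.rpow_add (by norm_num)]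
      ring_nf; simp
    have h3 : (2 : ℝ) ^ n * (1 / 2) ^ n = 1 := by rw [← mul_pow]; norm_num
    have h4 : (0 : ℝ) < 2 ^ (1 - ρa - ρb) := by positivity
    rw [hW]
    calc (2 : ℝ) ^ (1 - ρa - ρb) = 2 ^ (1 - ρa - ρb) * 2 ^ n * (1 / 2) ^ n := by
          rw [mul_assoc, h3, mul_one]
      _ ≤ 2 ^ (1 - ρa - ρb) * 2 ^ n * (2 ^ (ρa + ρb - 1) * M) := by gcongr
      _ = (2 ^ (1 - ρa - ρb) * 2 ^ (ρa + ρb - 1)) * (2 ^ n * M) := by ring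
      _ = 2 ^ n * M := by rw [h2, one_mul]
  · intro z hz
    rw [frontier_ball _ one_ne_zero, mem_sphere_zero_iff_norm] at hz
    rw [norm_mul, norm_mul, Complex.norm_cpow_real, Complex.norm_cpow_real, one_mul, neg_one_mul,
      ← sub_eq_add_neg]
    refine abs_le_of_sq_le_sq' ?_ (by positivity) |>.2
    rw [mul_pow, sq_circle_weight s t hz, hBn z hz, mul_pow, hexp, mul_assoc]
    have := hmaj z.re (re_mem_Icc_of_norm_eq_one hz)
    rw [majorant, ← hs, ← ht] at this
    gcongr

lemma norm_one_sub_le_mul_norm_one_sub_mul {ρ : ℝ} (h0 : 0 < ρ) {z : ℂ} (hz : ‖z‖ = 1) :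
    ‖1 - z‖ ≤ 2 / (1 + ρ) * ‖1 - ρ * z‖ := by
  have h : z.re * z.re + z.im * z.im = 1 := by
    rw [← Complex.normSq_apply, Complex.normSq_eq_norm_sq, hz]; norm_num
  have hx := (re_mem_Icc_of_norm_eq_one hz).1
  have h1 : ‖1 - (ρ : ℂ) * z‖ ^ 2 = 1 - 2 * ρ * z.re + ρ ^ 2 := by
    rw [← Complex.normSq_eq_norm_sq, Complex.normSq_apply]
    simp only [Complex.sub_re, Complex.sub_im, Complex.one_re, Complex.one_im,
      Complex.re_ofReal_mul, Complex.im_ofReal_mul]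
    linear_combination ρ ^ 2 * h
  refine abs_le_of_sq_le_sq' ?_ (by positivity) |>.2
  rw [mul_pow, h1, sq_norm_one_sub hz, div_pow, div_mul_eq_mul_div, le_div_iff₀ (by positivity)]
  nlinarith [mul_nonneg (sq_nonneg (1 - ρ)) (by linarith : 0 ≤ 1 + z.re)]

open Polynomial in
/-- Polynomials approximating `(1 - z) ^ (-s)` on the unit circle in the weighted sense. -/
lemma exists_weighted_approx {s : ℝ} (hs : 0 ≤ s) {ε : ℝ} (hε : 0 < ε) :
    ∃ r : ℝ[X], r.coeff 0 = 1 ∧ ∀ z : ℂ, ‖z‖ = 1 → ‖1 - z‖ ^ s * ‖aeval z r‖ ≤ 1 + ε := by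
  obtain ⟨ρ, hρε, hρ0, hρ1⟩ : ∃ ρ : ℝ, (2 / (1 + ρ)) ^ s < 1 + ε / 2 ∧ 0 < ρ ∧ ρ < 1 := by
    have hc : ContinuousAt (fun ρ : ℝ => (2 / (1 + ρ)) ^ s) 1 :=
      (ContinuousAt.div (by fun_prop) (by fun_prop) (by norm_num)).rpow_const (Or.inr hs)
    have h1 : ∀ᶠ ρ in nhds (1 : ℝ), (2 / (1 + ρ)) ^ s < 1 + ε / 2 :=
      hc.eventually_lt continuousAt_const (by norm_num; linarith)
    have h2 : ∀ᶠ ρ in nhds (1 : ℝ), 0 < ρ := lt_mem_nhds one_pos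
    have h3 := nhdsWithin_le_nhds (s := Set.Iio (1 : ℝ)) (h1.and h2)
    obtain ⟨ρ, h, h'⟩ := (Filter.Eventually.and h3 self_mem_nhdsWithin).exists
    exact ⟨ρ, h.1, h.2, h'⟩
  obtain ⟨σ, hρσ, hσ1⟩ := exists_between hρ1
  have hσ0 : 0 ≤ σ := (hρ0.trans hρσ).le
  lift σ to NNReal using hσ0
  have hlt : (σ : ENNReal) < 1 := by exact_mod_cast hσ1
  have hu := (Complex.one_add_cpow_hasFPowerSeriesOnBall_zero
    (a := ((-s : ℝ) : ℂ))).tendstoUniformlyOn hlt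
  have h2s : (0 : ℝ) < 2 ^ s := by positivity
  obtain ⟨m, hm, hm0⟩ := ((Metric.tendstoUniformlyOn_iff.mp hu (ε / (2 * 2 ^ s))
    (by positivity)).and (eventually_ge_atTop 1)).exists
  refine ⟨∑ k ∈ Finset.range m, monomial k (Ring.choose (-s) k * (-ρ) ^ k), ?_, fun z hz => ?_⟩
  · rw [finsetSum_coeff, Finset.sum_eq_single 0]
    · simp
    · intro k _ hk
      simp [coeff_monomial, hk]
    · intro h
      simp at h
      omega
  · have hy : ‖-((ρ : ℂ) * z)‖ = ρ := by
      rw [norm_neg, norm_mul, hz, mul_one, Complex.norm_of_nonneg hρ0.le]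
    have hsum : (binomialSeries ℂ ((-s : ℝ) : ℂ)).partialSum m (-((ρ : ℂ) * z)) =
        aeval z (∑ k ∈ Finset.range m, monomial k (Ring.choose (-s) k * (-ρ) ^ k)) := by
      rw [FormalMultilinearSeries.partialSum, map_sum]
      refine Finset.sum_congr rfl fun k _ => ?_
      rw [binomialSeries_apply, ← Complex.ofReal_choose, aeval_monomial, List.ofFn_const,
        List.prod_replicate, smul_eq_mul, ← neg_mul, mul_pow]
      simp [mul_assoc]
    have hm' := hm (-((ρ : ℂ) * z)) (by rw [mem_ball_zero_iff, hy]; exact hρσ)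
    rw [hsum, zero_add, ← sub_eq_add_neg, dist_eq_norm] at hm'
    have hpos : 0 < ‖1 - (ρ : ℂ) * z‖ := by
      refine norm_pos_iff.mpr fun h => ?_
      rw [sub_eq_zero] at h
      rw [norm_neg, ← h, norm_one] at hy
      exact hρ1.ne hy.symm
    have h1 : ‖(1 - (ρ : ℂ) * z) ^ ((-s : ℝ) : ℂ)‖ = (‖1 - (ρ : ℂ) * z‖ ^ s)⁻¹ := by
      rw [Complex.norm_cpow_real, Real.rpow_neg hpos.le]
    have h2 : ‖1 - z‖ ≤ 2 := by
      calc ‖1 - z‖ ≤ ‖(1 : ℂ)‖ + ‖z‖ := norm_sub_le _ _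
        _ = 2 := by rw [hz, norm_one]; norm_num
    have h3 : ‖1 - z‖ ^ s * (‖1 - (ρ : ℂ) * z‖ ^ s)⁻¹ ≤ (2 / (1 + ρ)) ^ s := by
      rw [← div_eq_mul_inv, div_le_iff₀ (by positivity),
        ← Real.mul_rpow (by positivity) hpos.le]
      exact Real.rpow_le_rpow (norm_nonneg _) (norm_one_sub_le_mul_norm_one_sub_mul hρ0 hz) hs
    set w := aeval z (∑ k ∈ Finset.range m, monomial k (Ring.choose (-s) k * (-ρ) ^ k))
    have h4 : ‖w‖ ≤ (‖1 - (ρ : ℂ) * z‖ ^ s)⁻¹ + ε / (2 * 2 ^ s) := by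
      have := norm_sub_norm_le w ((1 - (ρ : ℂ) * z) ^ ((-s : ℝ) : ℂ))
      rw [norm_sub_rev, h1] at this
      linarith
    calc ‖1 - z‖ ^ s * ‖w‖
        ≤ ‖1 - z‖ ^ s * ((‖1 - (ρ : ℂ) * z‖ ^ s)⁻¹ + ε / (2 * 2 ^ s)) := by gcongr
      _ = ‖1 - z‖ ^ s * (‖1 - (ρ : ℂ) * z‖ ^ s)⁻¹ + ‖1 - z‖ ^ s * (ε / (2 * 2 ^ s)) := by ring
      _ ≤ (2 / (1 + ρ)) ^ s + 2 ^ s * (ε / (2 * 2 ^ s)) := by gcongr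
      _ = (2 / (1 + ρ)) ^ s + ε / 2 := by field_simp
      _ ≤ 1 + ε := by linarith

open Polynomial in
/-- The monic polynomial with
`2 ^ n * sin θ * P (cos θ) = Im (exp (i (n + 1) θ) * r (exp (-i θ)))`, where `n = deg r`. -/
noncomputable def bernsteinSzego (r : ℝ[X]) : ℝ[X] :=
  ∑ k ∈ Finset.range (r.natDegree + 1),
    C ((1 / 2) ^ r.natDegree * r.coeff k) * Chebyshev.U ℝ ((r.natDegree - k : ℕ) : ℤ)

open Polynomial in
lemma natDegree_bernsteinSzego_le (r : ℝ[X]) :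
    (bernsteinSzego r).natDegree ≤ r.natDegree := by
  refine natDegree_sum_le_of_forall_le _ _ fun k _ => (natDegree_C_mul_le _ _).trans ?_
  rw [Chebyshev.natDegree_U_natCast]
  omega

open Polynomial in
lemma coeff_bernsteinSzego {r : ℝ[X]} (hr : r.coeff 0 = 1) :
    (bernsteinSzego r).coeff r.natDegree = 1 := by
  rw [bernsteinSzego, finsetSum_coeff, Finset.sum_eq_single 0]
  · have h := Chebyshev.leadingCoeff_U_natCast ℝ r.natDegree
    rw [leadingCoeff, Chebyshev.natDegree_U_natCast] at h
    rw [coeff_C_mul, hr, Nat.sub_zero, h, mul_one, ← mul_pow]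
    norm_num
  · intro k hk hk0
    rw [coeff_C_mul, coeff_eq_zero_of_natDegree_lt (p := Chebyshev.U _ _), mul_zero]
    rw [Chebyshev.natDegree_U_natCast]
    have := Finset.mem_range.mp hk
    omega
  · simp

open Polynomial in
lemma bernsteinSzego_eval_cos (r : ℝ[X]) (θ : ℝ) :
    2 ^ r.natDegree * ((bernsteinSzego r).eval (Real.cos θ) * Real.sin θ) =
      (Complex.exp (((r.natDegree + 1) * θ : ℝ) * Complex.I) *
        aeval (Complex.exp ((-θ : ℝ) * Complex.I)) r).im := by
  rw [bernsteinSzego, eval_finsetSum, Finset.sum_mul, Finset.mul_sum, aeval_eq_sum_range,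
    Finset.mul_sum, Complex.im_sum]
  refine Finset.sum_congr rfl fun k hk => ?_
  have hk' : k ≤ r.natDegree := Nat.lt_succ_iff.mp (Finset.mem_range.mp hk)
  have h2 : (2 : ℝ) ^ r.natDegree * (1 / 2) ^ r.natDegree = 1 := by
    rw [← mul_pow]; norm_num
  rw [eval_mul, eval_C, mul_assoc _ (eval _ _), Chebyshev.U_real_cos, Complex.real_smul,
    ← Complex.exp_nat_mul, mul_left_comm (Complex.exp _), ← Complex.exp_add, Complex.im_ofReal_mul]
  have h3 : ((((r.natDegree + 1) * θ : ℝ) : ℂ) * Complex.I + (k : ℂ) * (((-θ : ℝ) : ℂ) * Complex.I))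
      = (((((r.natDegree - k : ℕ) : ℤ) : ℝ) + 1) * θ : ℝ) * Complex.I := by
    push_cast [Nat.cast_sub hk']
    ring
  rw [h3, Complex.exp_ofReal_mul_I_im, ← mul_assoc, ← mul_assoc, h2,
    one_mul]

open Polynomial in
lemma widomFactor_le_of_circle_bound {ρa ρb : ℝ} (ha : 1 / 2 ≤ ρa) (hb : 1 / 2 ≤ ρb)
    {r : ℝ[X]} (hr : r.coeff 0 = 1) {K : ℝ} (hK : 0 ≤ K)
    (h : ∀ z : ℂ, ‖z‖ = 1 →
      ‖1 - z‖ ^ (2 * ρa - 1) * ‖1 + z‖ ^ (2 * ρb - 1) * ‖aeval z r‖ ≤ K) :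
    widomFactor ρa ρb r.natDegree ≤ 2 ^ (1 - ρa - ρb) * K := by
  have hle := natDegree_bernsteinSzego_le r
  have hco := coeff_bernsteinSzego hr
  have h2n : (0 : ℝ) < 2 ^ r.natDegree := by positivity
  have key := widomFactor_le (ρa := ρa) (ρb := ρb) (by linarith) (by linarith)
    (monic_of_natDegree_le_of_coeff_eq_one _ hle hco)
    (natDegree_eq_of_le_of_coeff_ne_zero hle (by rw [hco]; exact one_ne_zero))
    (C := 2 ^ (1 - ρa - ρb) * K / 2 ^ r.natDegree) ?_
  · rwa [mul_div_cancel₀ _ h2n.ne'] at key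
  intro x hx
  rw [le_div_iff₀ h2n]
  obtain ⟨θ, rfl⟩ : ∃ θ, Real.cos θ = x := ⟨_, Real.cos_arccos hx.1 hx.2⟩
  set z := Complex.exp ((-θ : ℝ) * Complex.I) with hz
  have hz1 : ‖z‖ = 1 := Complex.norm_exp_ofReal_mul_I _
  have hzre : z.re = Real.cos θ := by rw [hz, Complex.exp_ofReal_mul_I_re, Real.cos_neg]
  have h1 : |2 ^ r.natDegree * ((bernsteinSzego r).eval (Real.cos θ) * Real.sin θ)| ≤
      ‖aeval z r‖ := by
    rw [bernsteinSzego_eval_cos]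
    refine (Complex.abs_im_le_norm _).trans ?_
    rw [norm_mul, Complex.norm_exp_ofReal_mul_I, one_mul]
  have h2 := sq_circle_weight (2 * ρa - 1) (2 * ρb - 1) hz1
  have hexp : (2 ^ (1 - ρa - ρb)) ^ 2 * (2 : ℝ) ^ (2 * ρa - 1 + (2 * ρb - 1)) = 1 := by
    rw [← Real.rpow_natCast, ← Real.rpow_mul (by norm_num), ← Real.rpow_add (by norm_num)]
    push_cast
    ring_nf
    simp
  have hJ : 0 ≤ jacobiWeight (2 * ρa - 1) (2 * ρb - 1) (Real.cos θ) := jacobiWeight_nonneg hx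
  refine abs_le_of_sq_le_sq' ?_ (by positivity) |>.2
  calc (jacobiWeight ρa ρb (Real.cos θ) * |(bernsteinSzego r).eval (Real.cos θ)|
          * 2 ^ r.natDegree) ^ 2
      = jacobiWeight ρa ρb (Real.cos θ) ^ 2 *
          (2 ^ r.natDegree * (bernsteinSzego r).eval (Real.cos θ)) ^ 2 := by
        rw [mul_pow, mul_pow, sq_abs]; ring
    _ = jacobiWeight (2 * ρa - 1) (2 * ρb - 1) (Real.cos θ) *
          |2 ^ r.natDegree * ((bernsteinSzego r).eval (Real.cos θ) * Real.sin θ)| ^ 2 := by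
        rw [jacobiWeight_sq ha hb hx, sq_abs, ← Real.sin_sq]; ring
    _ ≤ jacobiWeight (2 * ρa - 1) (2 * ρb - 1) (Real.cos θ) * ‖aeval z r‖ ^ 2 := by gcongr
    _ = ((2 ^ (1 - ρa - ρb)) ^ 2 * (2 : ℝ) ^ (2 * ρa - 1 + (2 * ρb - 1))) *
          jacobiWeight (2 * ρa - 1) (2 * ρb - 1) (Real.cos θ) * ‖aeval z r‖ ^ 2 := by
        rw [hexp, one_mul]
    _ = (2 ^ (1 - ρa - ρb) * (‖1 - z‖ ^ (2 * ρa - 1) * ‖1 + z‖ ^ (2 * ρb - 1) *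
          ‖aeval z r‖)) ^ 2 := by
        rw [mul_pow _ (_ * _), mul_pow _ ‖aeval z r‖, h2, hzre]; ring
    _ ≤ (2 ^ (1 - ρa - ρb) * K) ^ 2 := by
        have := h z hz1
        gcongr

open Polynomial in
lemma exists_widomFactor_le {ρa ρb : ℝ} (ha : 1 / 2 ≤ ρa) (hb : 1 / 2 ≤ ρb) {ε : ℝ}
    (hε : 0 < ε) : ∃ n, widomFactor ρa ρb n ≤ 2 ^ (1 - ρa - ρb) * (1 + ε) ^ 2 := by
  obtain ⟨r, hr0, hr⟩ := exists_weighted_approx (s := 2 * ρa - 1) (by linarith) hε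
  obtain ⟨q, hq0, hq⟩ := exists_weighted_approx (s := 2 * ρb - 1) (by linarith) hε
  refine ⟨_, widomFactor_le_of_circle_bound ha hb (r := r * q.comp (-X)) ?_ (by positivity)
    fun z hz => ?_⟩
  · rw [mul_coeff_zero, hr0, coeff_zero_eq_eval_zero, eval_comp]
    simpa [coeff_zero_eq_eval_zero] using hq0
  · have h1 := hr z hz
    have h2 := hq (-z) (by rwa [norm_neg])
    rw [sub_neg_eq_add] at h2
    have h3 : aeval z (q.comp (-X)) = aeval (-z) q := by rw [aeval_comp]; simp
    rw [map_mul, h3, norm_mul]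
    calc _ = (‖1 - z‖ ^ (2 * ρa - 1) * ‖aeval z r‖) *
          (‖1 + z‖ ^ (2 * ρb - 1) * ‖aeval (-z) q‖) := by ring
      _ ≤ (1 + ε) * (1 + ε) := by gcongr
      _ = (1 + ε) ^ 2 := by ring

theorem widomFactor_decreasing_upper_bound (ρa ρb : ℝ)
    (hρa : 1 / 2 ≤ ρa) (hρb : 1 / 2 ≤ ρb) :
    (∀ n : ℕ, widomFactor ρa ρb n ≤
        (2 * ρa / (ρa + ρb)) ^ ρa * (2 * ρb / (ρa + ρb)) ^ ρb) ∧
      Antitone (fun n : ℕ => widomFactor ρa ρb n) ∧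
      (∀ n : ℕ, (2 : ℝ) ^ (1 - ρa - ρb) ≤ widomFactor ρa ρb n) ∧
      Tendsto (fun n : ℕ => widomFactor ρa ρb n) atTop
        (nhds ((2 : ℝ) ^ (1 - ρa - ρb))) := by
  have hanti := antitone_widomFactor hρa hρb
  have hlower := le_widomFactor hρa hρb
  refine ⟨fun n => (hanti n.zero_le).trans (widomFactor_zero_le (by linarith) (by linarith)),
    hanti, hlower, tendsto_order.2 ⟨fun a h => .of_forall fun n => h.trans_le (hlower n),
    fun a h => ?_⟩⟩
  have hc : ContinuousAt (fun ε : ℝ => (2 : ℝ) ^ (1 - ρa - ρb) * (1 + ε) ^ 2) 0 := by fun_prop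
  have h1 : ∀ᶠ ε in nhds (0 : ℝ), (2 : ℝ) ^ (1 - ρa - ρb) * (1 + ε) ^ 2 < a :=
    hc.eventually_lt continuousAt_const (by simpa using h)
  obtain ⟨ε, hε, hε0⟩ := (Filter.Eventually.and (nhdsWithin_le_nhds (s := Set.Ioi (0 : ℝ)) h1)
    self_mem_nhdsWithin).exists
  obtain ⟨N, hN⟩ := exists_widomFactor_le hρa hρb hε0
  filter_upwards [eventually_ge_atTop N] with n hn
  exact (hanti hn).trans_lt (hN.trans_lt hε)
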